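/- Let L be a d-generator generalized Heisenberg Lie algebra over a field k with d ≥ 3 and dim L² = ½d(d−1) − 3. Then the subspace K of L² ⊗ (L/L²) spanned by the elements [x,y]⊗(z+L²) + [z,x]⊗(y+L²) + [y,z]⊗(x+L²) for x, y, z ∈ L has dimension equal to (1/6)d(d−1)(d−2) or (1/6)d(d−1)(d−2) − 1. -/

import Mathlib

open Module TensorProduct

variable (k : Type*) [Field k]

/-- The derived subalgebra `L² = [L,L]` of a Lie algebra, as a `k`-submodule. -/
abbrev lieSq (L : Type*) [LieRing L] [LieAlgebra k L] : Submodule k L :=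
  (LieModule.lowerCentralSeries k L L 1).toSubmodule

lemma lie_mem_lieSq {L : Type*} [LieRing L] [LieAlgebra k L] (x y : L) :
    ⁅x, y⁆ ∈ lieSq k L := by
  have : ⁅x, y⁆ ∈ LieModule.lowerCentralSeries k L L 1 := by
    rw [LieModule.lowerCentralSeries_succ, LieModule.lowerCentralSeries_zero]
    exact LieSubmodule.lie_mem_lie (LieSubmodule.mem_top x) (LieSubmodule.mem_top y)
  exact this

/-- The subspace `K` of `L² ⊗ (L/L²)` spanned by the elements
`[x,y]⊗z̄ + [z,x]⊗ȳ + [y,z]⊗x̄`. -/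
abbrev Ksub (L : Type*) [LieRing L] [LieAlgebra k L] :
    Submodule k (TensorProduct k (lieSq k L) (L ⧸ lieSq k L)) :=
  Submodule.span k
    { t | ∃ x y z : L,
      t = (⟨⁅x, y⁆, lie_mem_lieSq k x y⟩ : lieSq k L) ⊗ₜ[k]
            (Submodule.Quotient.mk z : L ⧸ lieSq k L)
        + (⟨⁅z, x⁆, lie_mem_lieSq k z x⟩ : lieSq k L) ⊗ₜ[k]
            (Submodule.Quotient.mk y : L ⧸ lieSq k L)
        + (⟨⁅y, z⁆, lie_mem_lieSq k y z⟩ : lieSq k L) ⊗ₜ[k]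
            (Submodule.Quotient.mk x : L ⧸ lieSq k L) }

section Alternating

variable {k} {V M : Type*} [AddCommGroup V] [Module k V] [AddCommGroup M] [Module k M]

/-- An alternating bilinear map, viewed as an alternating map on `Fin 2`. -/
def alternatingMapOfBilin (β : V →ₗ[k] V →ₗ[k] M) (hβ : ∀ x, β x x = 0) :
    V [⋀^Fin 2]→ₗ[k] M where
  toFun v := β (v 0) (v 1)
  map_update_add' v i x y := by
    have h01 : (0 : Fin 2) ≠ 1 := Fin.ne_of_val_ne (by decide)
    obtain rfl | rfl : i = 0 ∨ i = 1 := by lia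
    all_goals simp only [Function.update_self, Function.update_of_ne h01,
      Function.update_of_ne h01.symm, map_add, LinearMap.add_apply]
  map_update_smul' v i c x := by
    have h01 : (0 : Fin 2) ≠ 1 := Fin.ne_of_val_ne (by decide)
    obtain rfl | rfl : i = 0 ∨ i = 1 := by lia
    all_goals simp only [Function.update_self, Function.update_of_ne h01,
      Function.update_of_ne h01.symm, map_smul, LinearMap.smul_apply]
  map_eq_zero_of_eq' v i j h hij := by
    have : v 0 = v 1 := by
      obtain ⟨rfl, rfl⟩ | ⟨rfl, rfl⟩ : (i = 0 ∧ j = 1) ∨ (i = 1 ∧ j = 0) := by lia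
      exacts [h, h.symm]
    rw [this, hβ]

/-- The alternating map `(x, y, z) ↦ β(x, y) ⊗ z + β(z, x) ⊗ y + β(y, z) ⊗ x` attached to an
alternating bilinear map `β`. -/
def cyclicTensor (β : V →ₗ[k] V →ₗ[k] M) (hβ : ∀ x, β x x = 0) :
    V [⋀^Fin 3]→ₗ[k] (M ⊗[k] V) where
  toFun v := β (v 0) (v 1) ⊗ₜ[k] v 2 + β (v 2) (v 0) ⊗ₜ[k] v 1 + β (v 1) (v 2) ⊗ₜ[k] v 0
  map_update_add' v i x y := by
    have h01 : (0 : Fin 3) ≠ 1 := Fin.ne_of_val_ne (by decide)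
    have h02 : (0 : Fin 3) ≠ 2 := Fin.ne_of_val_ne (by decide)
    have h12 : (1 : Fin 3) ≠ 2 := Fin.ne_of_val_ne (by decide)
    obtain rfl | rfl | rfl : i = 0 ∨ i = 1 ∨ i = 2 := by lia
    all_goals
      simp only [Function.update_self, Function.update_of_ne h01, Function.update_of_ne h01.symm,
        Function.update_of_ne h02, Function.update_of_ne h02.symm, Function.update_of_ne h12,
        Function.update_of_ne h12.symm, map_add, LinearMap.add_apply, add_tmul, tmul_add]
      abel
  map_update_smul' v i c x := by
    have h01 : (0 : Fin 3) ≠ 1 := Fin.ne_of_val_ne (by decide)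
    have h02 : (0 : Fin 3) ≠ 2 := Fin.ne_of_val_ne (by decide)
    have h12 : (1 : Fin 3) ≠ 2 := Fin.ne_of_val_ne (by decide)
    obtain rfl | rfl | rfl : i = 0 ∨ i = 1 ∨ i = 2 := by lia
    all_goals
      simp only [Function.update_self, Function.update_of_ne h01, Function.update_of_ne h01.symm,
        Function.update_of_ne h02, Function.update_of_ne h02.symm, Function.update_of_ne h12,
        Function.update_of_ne h12.symm, map_smul, LinearMap.smul_apply, smul_tmul', tmul_smul,
        smul_add]
  map_eq_zero_of_eq' v i j h hij := by
    have hs (x y : V) : β y x = - β x y := by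
      have := hβ (x + y)
      simp only [map_add, LinearMap.add_apply, hβ, zero_add, add_zero] at this
      exact eq_neg_of_add_eq_zero_left this
    obtain h | h | h : v 0 = v 1 ∨ v 0 = v 2 ∨ v 1 = v 2 := by grind
    · rw [h, hβ, hs (v 1) (v 2), neg_tmul]
      simp
    · rw [h, hβ, hs (v 1) (v 2), neg_tmul]
      simp
    · rw [h, hβ, hs (v 0) (v 2), neg_tmul]
      simp

lemma cyclicTensor_apply (β : V →ₗ[k] V →ₗ[k] M) (hβ : ∀ x, β x x = 0) (v : Fin 3 → V) :
    cyclicTensor β hβ v =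
      β (v 0) (v 1) ⊗ₜ[k] v 2 + β (v 2) (v 0) ⊗ₜ[k] v 1 + β (v 1) (v 2) ⊗ₜ[k] v 0 := rfl

variable (M) in
/-- Contraction of the right tensor factor by a linear form. -/
def tensorContractRight (φ : Dual k V) : M ⊗[k] V →ₗ[k] M :=
  (TensorProduct.rid k M).toLinearMap ∘ₗ φ.lTensor M

variable (k V) in
/-- The wedge product `V × V → ⋀² V` as a bilinear map. -/
def wedge : V →ₗ[k] V →ₗ[k] ⋀[k]^2 V :=
  LinearMap.mk₂ k (fun x y ↦ exteriorPower.ιMulti k 2 ![x, y])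
    (fun x x' y ↦ (exteriorPower.ιMulti k 2).map_vecCons_add ![y] x x')
    (fun c x y ↦ (exteriorPower.ιMulti k 2).map_vecCons_smul ![y] c x)
    (fun x y y' ↦ ((exteriorPower.ιMulti k 2).curryLeft x).map_vecCons_add ![] y y')
    (fun c x y ↦ ((exteriorPower.ιMulti k 2).curryLeft x).map_vecCons_smul ![] c y)

lemma wedge_apply (x y : V) : wedge k V x y = exteriorPower.ιMulti k 2 ![x, y] := rfl

lemma wedge_self (x : V) : wedge k V x x = 0 :=
  (exteriorPower.ιMulti k 2).map_eq_zero_of_eq ![x, x] (i := 0) (j := 1) rfl (by decide)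

lemma exteriorPower.eq_zero_of_pairingDual_eq_zero (n : ℕ) (t : ⋀[k]^n V)
    (h : ∀ f : Fin n → Dual k V,
      exteriorPower.pairingDual k V n (exteriorPower.ιMulti k n f) t = 0) : t = 0 := by
  classical
  let b := Basis.ofVectorSpace k V
  let : LinearOrder (Basis.ofVectorSpaceIndex k V) := linearOrderOfSTO WellOrderingRel
  apply (b.exteriorPower n).repr.injective
  ext s
  rw [exteriorPower.basis_repr_apply]
  rw [map_zero]
  exact h _

/-- Two alternating trilinear forms, all of whose contractions lie in a common space of dimension
at most three, are proportional. -/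
lemma AlternatingMap.exists_smul_eq_of_contraction_mem (R : Submodule k (V → V → k))
    [FiniteDimensional k R] (hR : finrank k R ≤ 3) (s s' : V [⋀^Fin 3]→ₗ[k] k)
    (hs : ∀ x, (fun y z ↦ s ![x, y, z]) ∈ R) (hs' : ∀ x, (fun y z ↦ s' ![x, y, z]) ∈ R)
    (h0 : s ≠ 0) : ∃ c : k, c • s = s' := by
  have swap₁ (u : V [⋀^Fin 3]→ₗ[k] k) (x y z : V) : u ![x, y, z] = - u ![y, x, z] := by
    have := u.map_swap ![y, x, z] (i := 0) (j := 1) (by decide)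
    rw [← this]
    congr 1
    ext i
    fin_cases i <;> rfl
  have swap₂ (u : V [⋀^Fin 3]→ₗ[k] k) (x y z : V) : u ![x, y, z] = - u ![x, z, y] := by
    have := u.map_swap ![x, z, y] (i := 1) (j := 2) (by decide)
    rw [← this]
    congr 1
    ext i
    fin_cases i <;> rfl
  obtain ⟨v, hv⟩ : ∃ v, s v ≠ 0 := by
    by_contra! h
    exact h0 (AlternatingMap.ext h)
  have hv3 : ![v 0, v 1, v 2] = v := by
    ext i
    fin_cases i <;> rfl
  let w : Fin 3 → R := fun i ↦ ⟨_, hs (v i)⟩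
  have zero₁ (x z : V) : s ![x, x, z] = 0 :=
    s.map_eq_zero_of_eq _ (i := 0) (j := 1) rfl (by decide)
  have zero₃ (x z : V) : s ![x, z, x] = 0 :=
    s.map_eq_zero_of_eq _ (i := 0) (j := 2) rfl (by decide)
  have hw : LinearIndependent k w := by
    rw [Fintype.linearIndependent_iff]
    intro g hg
    have key (y z : V) : ∑ i, g i * s ![v i, y, z] = 0 := by
      have := congrFun (congrFun (congrArg Subtype.val hg) y) z
      simpa [w, Finset.sum_apply] using this
    have h3 := key (v 1) (v 2)
    have h4 := key (v 2) (v 0)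
    have h5 := key (v 0) (v 1)
    have e1 : s ![v 1, v 2, v 0] = s v := by rw [swap₂, swap₁, neg_neg, hv3]
    have e2 : s ![v 2, v 0, v 1] = s v := by rw [swap₁, swap₂, neg_neg, hv3]
    simp only [Fin.sum_univ_three, zero₁, zero₃, hv3, e1, e2, mul_zero, add_zero, zero_add,
      mul_eq_zero, hv, or_false] at h3 h4 h5
    intro i
    fin_cases i <;> assumption
  have hspan : Submodule.span k (Set.range w) = ⊤ :=
    hw.span_eq_top_of_card_eq_finrank' (le_antisymm hw.fintype_card_le_finrank (by simpa using hR))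
  have expand (f : V → V → k) (hf : f ∈ R) :
      ∃ α : Fin 3 → k, ∀ y z, f y z = ∑ i, α i * s ![v i, y, z] := by
    have : (⟨f, hf⟩ : R) ∈ Submodule.span k (Set.range w) := hspan ▸ Submodule.mem_top
    obtain ⟨α, hα⟩ := (Submodule.mem_span_range_iff_exists_fun k).1 this
    refine ⟨α, fun y z ↦ ?_⟩
    have := congrFun (congrFun (congrArg Subtype.val hα) y) z
    simpa [w, Finset.sum_apply] using this.symm
  have expand_both (x : V) : ∃ α : Fin 3 → k, ∀ y z,
      s ![x, y, z] = ∑ i, α i * s ![v i, y, z] ∧ s' ![x, y, z] = ∑ i, α i * s' ![v i, y, z] := by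
    obtain ⟨α, hα⟩ := expand _ (hs x)
    refine ⟨α, fun y z ↦ ⟨hα y z, ?_⟩⟩
    obtain ⟨β, hβ⟩ := expand _ (hs' y)
    have hβ' (x' : V) : s' ![x', y, z] = ∑ j, β j * s ![x', v j, z] := by
      rw [swap₁, hβ, ← Finset.sum_neg_distrib]
      exact Finset.sum_congr rfl fun j _ ↦ by rw [swap₁ s x', mul_neg]
    simp only [hβ', hα, Finset.mul_sum]
    rw [Finset.sum_comm]
    exact Finset.sum_congr rfl fun _ _ ↦ Finset.sum_congr rfl fun _ _ ↦ by ring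
  refine ⟨s' v / s v, ?_⟩
  rw [← sub_eq_zero]
  set u := (s' v / s v) • s - s' with hu
  have huv : u v = 0 := by simp [hu, hv]
  have hx (x : V) : ∃ α : Fin 3 → k, ∀ y z, u ![x, y, z] = ∑ i, α i * u ![v i, y, z] := by
    obtain ⟨α, hα⟩ := expand_both x
    refine ⟨α, fun y z ↦ ?_⟩
    simp only [hu, AlternatingMap.sub_apply, AlternatingMap.smul_apply, (hα y z).1, (hα y z).2,
      mul_sub, Finset.sum_sub_distrib, smul_eq_mul, Finset.mul_sum]
    congr 1
    exact Finset.sum_congr rfl fun _ _ ↦ by ring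
  have u₃ (i j l : Fin 3) : u ![v i, v j, v l] = 0 := by
    have : ![v i, v j, v l] = v ∘ ![i, j, l] := by
      ext m
      fin_cases m <;> rfl
    rw [this]
    by_cases hσ : Function.Injective ![i, j, l]
    · have := u.map_perm v (Equiv.ofBijective _ (Finite.injective_iff_bijective.1 hσ))
      rw [huv, smul_zero] at this
      exact this
    · exact u.map_eq_zero_of_not_injective _ fun h ↦ hσ h.of_comp
  have u₂ (i j : Fin 3) (z : V) : u ![v i, v j, z] = 0 := by
    obtain ⟨α, hα⟩ := hx z
    rw [swap₂, swap₁, hα]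
    simp [u₃]
  have u₁ (i : Fin 3) (y z : V) : u ![v i, y, z] = 0 := by
    obtain ⟨α, hα⟩ := hx y
    rw [swap₁, hα]
    simp [u₂]
  ext m
  obtain ⟨α, hα⟩ := hx (m 0)
  have hm : ![m 0, m 1, m 2] = m := by
    ext i
    fin_cases i <;> rfl
  rw [← hm, hα]
  simp [u₁]

/-- If the map on `⋀² V` induced by the alternating bilinear map `β` has kernel of dimension at
most three, then the map on `⋀³ V` induced by `cyclicTensor β` has kernel of dimension at most
one. -/
lemma finrank_ker_cyclicTensor_le_one [FiniteDimensional k V]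
    (β : V →ₗ[k] V →ₗ[k] M) (hβ : ∀ x, β x x = 0)
    (hker : finrank k (LinearMap.ker
      (exteriorPower.alternatingMapLinearEquiv (alternatingMapOfBilin β hβ))) ≤ 3) :
    finrank k (LinearMap.ker
      (exteriorPower.alternatingMapLinearEquiv (cyclicTensor β hβ))) ≤ 1 := by
  set B := exteriorPower.alternatingMapLinearEquiv (alternatingMapOfBilin β hβ)
  set Ψ := exteriorPower.alternatingMapLinearEquiv (cyclicTensor β hβ)
  let Φ := exteriorPower.alternatingMapLinearEquiv (cyclicTensor (wedge k V) wedge_self)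
  let form (t : ⋀[k]^3 V) : Dual k V [⋀^Fin 3]→ₗ[k] k :=
    ((exteriorPower.pairingDual k V 3).flip t).compAlternatingMap (exteriorPower.ιMulti k 3)
  have form_apply (t) (f) : form t f =
    exteriorPower.pairingDual k V 3 (exteriorPower.ιMulti k 3 f) t := rfl
  let ev : ⋀[k]^2 V →ₗ[k] (Dual k V → Dual k V → k) :=
    LinearMap.pi fun ψ ↦ LinearMap.pi fun χ ↦
      exteriorPower.pairingDual k V 2 (exteriorPower.ιMulti k 2 ![ψ, χ])
  have ev_apply (r) (ψ χ) : ev r ψ χ =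
    exteriorPower.pairingDual k V 2 (exteriorPower.ιMulti k 2 ![ψ, χ]) r := rfl
  have form_eq (t) (φ) : (fun ψ χ ↦ form t ![φ, ψ, χ]) = ev (tensorContractRight _ φ (Φ t)) := by
    ext ψ χ
    rw [form_apply, ev_apply]
    suffices h : exteriorPower.pairingDual k V 3 (exteriorPower.ιMulti k 3 ![φ, ψ, χ]) =
        exteriorPower.pairingDual k V 2 (exteriorPower.ιMulti k 2 ![ψ, χ]) ∘ₗ tensorContractRight _ φ ∘ₗ Φ from
      LinearMap.congr_fun h t
    ext v
    simp [Φ, tensorContractRight, cyclicTensor_apply, wedge_apply, Matrix.det_fin_three, Matrix.det_fin_two]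
    ring
  have B_con (t) (φ) : B (tensorContractRight _ φ (Φ t)) = tensorContractRight _ φ (Ψ t) := by
    suffices h : B ∘ₗ tensorContractRight _ φ ∘ₗ Φ = tensorContractRight _ φ ∘ₗ Ψ from LinearMap.congr_fun h t
    ext v
    simp [B, Φ, Ψ, tensorContractRight, cyclicTensor_apply, wedge_apply, alternatingMapOfBilin]
  let R := (LinearMap.ker B).map ev
  have hR : finrank k R ≤ 3 := (Submodule.finrank_map_le _ _).trans hker
  have mem (t) (ht : t ∈ LinearMap.ker Ψ) (φ) : (fun ψ χ ↦ form t ![φ, ψ, χ]) ∈ R := by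
    rw [form_eq]
    refine Submodule.mem_map_of_mem ?_
    rw [LinearMap.mem_ker, B_con, LinearMap.mem_ker.1 ht, map_zero]
  have form_zero (t) (h : form t = 0) : t = 0 :=
    exteriorPower.eq_zero_of_pairingDual_eq_zero 3 t fun f ↦ by rw [← form_apply, h]; rfl
  by_cases hbot : LinearMap.ker Ψ = ⊥
  · rw [hbot, finrank_bot]
    exact zero_le_one
  obtain ⟨t, ht, ht0⟩ := Submodule.exists_mem_ne_zero_of_ne_bot hbot
  refine finrank_le_one ⟨t, ht⟩ fun ⟨t', ht'⟩ ↦ ?_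
  obtain ⟨c, hc⟩ := AlternatingMap.exists_smul_eq_of_contraction_mem R hR (form t) (form t')
    (mem t ht) (mem t' ht') (fun h ↦ ht0 (form_zero t h))
  refine ⟨c, Subtype.ext (sub_eq_zero.1 (form_zero _ ?_))⟩
  ext f
  have := DFunLike.congr_fun hc f
  simp only [AlternatingMap.smul_apply, form_apply, smul_eq_mul] at this
  simp [form_apply, ← this]

end Alternating

/-- The Lie bracket of a Lie algebra of class at most two, as an alternating bilinear map
`L/L² × L/L² → L²`. -/
lemma exists_bracket_quotient (L : Type*) [LieRing L] [LieAlgebra k L]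
    (hH : LieModule.lowerCentralSeries k L L 1 ≤ LieAlgebra.center k L) :
    ∃ β : (L ⧸ lieSq k L) →ₗ[k] (L ⧸ lieSq k L) →ₗ[k] lieSq k L, (∀ x, β x x = 0) ∧
      ∀ x y : L, β (Submodule.Quotient.mk x) (Submodule.Quotient.mk y) =
        ⟨⁅x, y⁆, lie_mem_lieSq k x y⟩ := by
  obtain ⟨σ, hσ⟩ := (lieSq k L).mkQ.exists_rightInverse_of_surjective (Submodule.range_mkQ _)
  let β : (L ⧸ lieSq k L) →ₗ[k] (L ⧸ lieSq k L) →ₗ[k] lieSq k L :=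
    LinearMap.mk₂ k (fun x y ↦ ⟨⁅σ x, σ y⁆, lie_mem_lieSq k _ _⟩)
      (fun _ _ _ ↦ Subtype.ext (by simp)) (fun _ _ _ ↦ Subtype.ext (by simp))
      (fun _ _ _ ↦ Subtype.ext (by simp)) (fun _ _ _ ↦ Subtype.ext (by simp))
  refine ⟨β, fun x ↦ Subtype.ext (lie_self _), fun x y ↦ Subtype.ext ?_⟩
  have hc (x : L) : σ (Submodule.Quotient.mk x) - x ∈ LieAlgebra.center k L := by
    refine hH ((Submodule.Quotient.eq (lieSq k L)).1 ?_)
    exact LinearMap.congr_fun hσ (Submodule.Quotient.mk x)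
  have hx (x z : L) : ⁅z, σ (Submodule.Quotient.mk x)⁆ = ⁅z, x⁆ := by
    rw [← sub_eq_zero, ← lie_sub]
    exact (LieModule.mem_maxTrivSubmodule _ _ _ _).1 (hc x) z
  change ⁅σ (Submodule.Quotient.mk x), σ (Submodule.Quotient.mk y)⁆ = ⁅x, y⁆
  rw [hx, ← lie_skew, hx, lie_skew]

/-- For a `d`-generator generalized Heisenberg Lie algebra with `d ≥ 3` and `dim L² = ½d(d−1) − 3`, the subspace `K` has dimension `d(d−1)(d−2)/6` or `d(d−1)(d−2)/6 − 1`. -/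
theorem stmt7 (L : Type*) [LieRing L] [LieAlgebra k L] [FiniteDimensional k L]
    (d : ℕ) (hd3 : 3 ≤ d)
    (hH : LieModule.lowerCentralSeries k L L 1 = LieAlgebra.center k L)
    (hgen : finrank k (L ⧸ lieSq k L) = d)
    (hrk : finrank k (lieSq k L) = d * (d - 1) / 2 - 3) :
    finrank k (Ksub k L) = d * (d - 1) * (d - 2) / 6 ∨
      finrank k (Ksub k L) = d * (d - 1) * (d - 2) / 6 - 1 := by
  obtain ⟨β, hβ, hβ_mk⟩ := exists_bracket_quotient k L hH.le
  set B := exteriorPower.alternatingMapLinearEquiv (alternatingMapOfBilin β hβ) with hB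
  set Ψ := exteriorPower.alternatingMapLinearEquiv (cyclicTensor β hβ) with hΨ
  have hΨ_range : LinearMap.range Ψ = Ksub k L := by
    rw [LinearMap.range_eq_map, ← exteriorPower.ιMulti_span, Submodule.map_span,
      ← Set.range_comp]
    congr 1
    ext t
    constructor
    · rintro ⟨v, rfl⟩
      obtain ⟨x, hx⟩ := Submodule.Quotient.mk_surjective _ (v 0)
      obtain ⟨y, hy⟩ := Submodule.Quotient.mk_surjective _ (v 1)
      obtain ⟨z, hz⟩ := Submodule.Quotient.mk_surjective _ (v 2)
      refine ⟨x, y, z, ?_⟩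
      simp [hΨ, cyclicTensor_apply, ← hx, ← hy, ← hz, hβ_mk]
    · rintro ⟨x, y, z, rfl⟩
      refine ⟨![Submodule.Quotient.mk x, Submodule.Quotient.mk y, Submodule.Quotient.mk z], ?_⟩
      simp [hΨ, cyclicTensor_apply, hβ_mk]
  have hB_range : LinearMap.range B = ⊤ := by
    apply Submodule.map_injective_of_injective (lieSq k L).injective_subtype
    rw [Submodule.map_top, Submodule.range_subtype]
    refine le_antisymm (Submodule.map_subtype_le _ _) ?_
    change (LieModule.lowerCentralSeries k L L 1).toSubmodule ≤ _
    rw [LieModule.lowerCentralSeries_succ, LieModule.lowerCentralSeries_zero,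
      LieSubmodule.lieIdeal_oper_eq_linear_span', Submodule.span_le]
    rintro _ ⟨x, -, y, -, rfl⟩
    refine ⟨β (Submodule.Quotient.mk x) (Submodule.Quotient.mk y),
      ⟨exteriorPower.ιMulti k 2 ![Submodule.Quotient.mk x, Submodule.Quotient.mk y], ?_⟩, ?_⟩
    · simp [hB, alternatingMapOfBilin]
    · simp [hβ_mk]
  have hd2 : 3 ≤ d.choose 2 := by simpa using Nat.choose_le_choose 2 hd3
  have hB_rank := B.finrank_range_add_finrank_ker
  rw [hB_range, finrank_top, exteriorPower.finrank_eq, hgen, hrk, ← Nat.choose_two_right] at hB_rank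
  have hΨ_rank := Ψ.finrank_range_add_finrank_ker
  rw [hΨ_range, exteriorPower.finrank_eq, hgen] at hΨ_rank
  have hker := finrank_ker_cyclicTensor_le_one β hβ (by rw [← hB]; lia)
  rw [← hΨ] at hker
  have hd : d.choose 3 = d * (d - 1) * (d - 2) / 6 := by
    rw [Nat.choose_eq_descFactorial_div_factorial]
    congr 1
    simp [Nat.descFactorial]
    ring
  lia
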